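/- Let S be a finite semigroup with a zero element 0 such that R(S) = {0}, and let x ∈ S be nonzero. Then there exist idempotents e, f ∈ S lying in the same minimal D-class (i.e., (e) = (f) and this D-class is minimal) such that exf ≠ 0. -/

import Mathlib

/-! Basic notions for nilpotent subsemigroups of a semigroup with zero,
following Ganyushkin–Mazorchuk, "On classification of maximal nilpotent
subsemigroups". -/

/-- The product `a * l₀ * l₁ * ⋯` of a nonempty list of semigroup elements
(the element `a` followed by the elements of the list `l`). -/
def prodl {S : Type*} [Mul S] (a : S) (l : List S) : S := l.foldl (· * ·) a

/-- `T` is a subsemigroup of `S`, i.e. closed under multiplication. -/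
def IsSubsgp {S : Type*} [Mul S] (T : Set S) : Prop :=
  ∀ ⦃a b : S⦄, a ∈ T → b ∈ T → a * b ∈ T

/-- Every product of `k` elements of `T` equals `0`. -/
def ProdZero {S : Type*} [Mul S] [Zero S] (T : Set S) (k : ℕ) : Prop :=
  ∀ (a : S) (l : List S), a ∈ T → (∀ x ∈ l, x ∈ T) → l.length + 1 = k →
    prodl a l = 0

/-- `T` is a nilpotent subsemigroup: it is closed under multiplication and some
positive power of it vanishes. -/
def IsNilpSubsgp {S : Type*} [Mul S] [Zero S] (T : Set S) : Prop :=
  IsSubsgp T ∧ ∃ k : ℕ, 1 ≤ k ∧ ProdZero T k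

/-- `k` is the nilpotency class of `T`: the least positive integer such that
every product of `k` elements of `T` equals `0`. -/
def NilpClass {S : Type*} [Mul S] [Zero S] (T : Set S) (k : ℕ) : Prop :=
  1 ≤ k ∧ ProdZero T k ∧ ∀ m : ℕ, 1 ≤ m → ProdZero T m → k ≤ m

/-- `T` is a maximal nilpotent subsemigroup of `S`: a maximal element of the
set of nilpotent subsemigroups of `S` ordered by inclusion. -/
def IsMaxNilpSubsgp {S : Type*} [Mul S] [Zero S] (T : Set S) : Prop :=
  IsNilpSubsgp T ∧ ∀ T' : Set S, IsNilpSubsgp T' → T ⊆ T' → T' = T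

/-- The principal left ideal `S¹a = {a} ∪ Sa`. -/
def lId {S : Type*} [Mul S] (a : S) : Set S := insert a {x | ∃ u, x = u * a}

/-- The principal right ideal `aS¹ = {a} ∪ aS`. -/
def rId {S : Type*} [Mul S] (a : S) : Set S := insert a {x | ∃ v, x = a * v}

/-- The principal two-sided ideal `(a) = S¹aS¹ = {a} ∪ Sa ∪ aS ∪ SaS`. -/
def pId {S : Type*} [Mul S] (a : S) : Set S :=
  insert a ({x | ∃ u, x = u * a} ∪ {x | ∃ v, x = a * v} ∪ {x | ∃ u v, x = u * a * v})

/-- The radical `R(S)`: the set of `x ∈ S` such that the subsemigroup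
`(x) = S¹xS¹` is nilpotent. -/
def radical (S : Type*) [Mul S] [Zero S] : Set S :=
  {x | ∃ k : ℕ, 1 ≤ k ∧ ProdZero (pId x) k}

/-- The J(=D for finite semigroups)-class of `a` is a minimal nonzero class:
`a ≠ 0` and every principal ideal contained in `(a)` is either `{0}` or equals
`(a)`. -/
def InMinClass {S : Type*} [Mul S] [Zero S] (a : S) : Prop :=
  a ≠ 0 ∧ ∀ b : S, pId b ⊆ pId a → b = 0 ∨ pId b = pId a

/-- A minimal idempotent: a nonzero idempotent lying in a minimal D-class. -/
def MinIdem {S : Type*} [Mul S] [Zero S] (e : S) : Prop :=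
  e * e = e ∧ InMinClass e

theorem mem_pId {S : Type*} [Mul S] {a x : S} :
    x ∈ pId a ↔ x = a ∨ (∃ u, x = u * a) ∨ (∃ v, x = a * v) ∨ ∃ u v, x = u * a * v := by
  simp [pId, or_assoc]

theorem mul_left_mem_pId {S : Type*} [Semigroup S] {a x : S} (c : S) (h : x ∈ pId a) :
    c * x ∈ pId a := by
  rw [mem_pId] at h ⊢
  rcases h with rfl | ⟨u, rfl⟩ | ⟨v, rfl⟩ | ⟨u, v, rfl⟩
  · exact .inr (.inl ⟨c, rfl⟩)
  · exact .inr (.inl ⟨c * u, by simp only [mul_assoc]⟩)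
  · exact .inr (.inr (.inr ⟨c, v, by simp only [mul_assoc]⟩))
  · exact .inr (.inr (.inr ⟨c * u, v, by simp only [mul_assoc]⟩))

theorem mul_right_mem_pId {S : Type*} [Semigroup S] {a x : S} (c : S) (h : x ∈ pId a) :
    x * c ∈ pId a := by
  rw [mem_pId] at h ⊢
  rcases h with rfl | ⟨u, rfl⟩ | ⟨v, rfl⟩ | ⟨u, v, rfl⟩
  · exact .inr (.inr (.inl ⟨c, rfl⟩))
  · exact .inr (.inr (.inr ⟨u, c, rfl⟩))
  · exact .inr (.inr (.inl ⟨v * c, by simp only [mul_assoc]⟩))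
  · exact .inr (.inr (.inr ⟨u, v * c, by simp only [mul_assoc]⟩))

theorem self_mem_pId {S : Type*} [Mul S] (a : S) : a ∈ pId a :=
  mem_pId.2 (.inl rfl)

theorem pId_subset_of_mem {S : Type*} [Semigroup S] {a b : S} (h : b ∈ pId a) :
    pId b ⊆ pId a := by
  intro x hx
  rw [mem_pId] at hx
  rcases hx with rfl | ⟨u, rfl⟩ | ⟨v, rfl⟩ | ⟨u, v, rfl⟩
  · exact h
  · exact mul_left_mem_pId u h
  · exact mul_right_mem_pId v h
  · exact mul_right_mem_pId v (mul_left_mem_pId u h)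

theorem prodl_append {S : Type*} [Mul S] (a : S) (l m : List S) :
    prodl a (l ++ m) = prodl (prodl a l) m :=
  List.foldl_append

theorem prodl_mul {S : Type*} [Semigroup S] (a b : S) (l : List S) :
    prodl (a * b) l = a * prodl b l := by
  induction l generalizing b with
  | nil => rfl
  | cons c l ih => simpa only [prodl, List.foldl_cons, mul_assoc] using ih (b * c)

theorem zero_prodl {S : Type*} [SemigroupWithZero S] (l : List S) : prodl (0 : S) l = 0 := by
  simpa using prodl_mul (0 : S) 0 l

theorem IsSubsgp.prodl_mem {S : Type*} [Mul S] {T : Set S} (hT : IsSubsgp T) {a : S}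
    {l : List S} (ha : a ∈ T) (hl : ∀ x ∈ l, x ∈ T) : prodl a l ∈ T := by
  induction l generalizing a with
  | nil => exact ha
  | cons b l ih =>
    exact ih (hT ha (hl b List.mem_cons_self)) fun x hx => hl x (List.mem_cons_of_mem b hx)

/-- In a finite semigroup every nonempty subsemigroup contains an idempotent. -/
theorem IsSubsgp.exists_idempotent {S : Type*} [Semigroup S] [Finite S] {T : Set S}
    (hT : IsSubsgp T) (hne : T.Nonempty) : ∃ e ∈ T, e * e = e := by
  let _ : TopologicalSpace S := ⊥
  have _ : DiscreteTopology S := ⟨rfl⟩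
  exact exists_idempotent_in_compact_subsemigroup (fun _ => continuous_of_discreteTopology) T hne
    T.toFinite.isCompact fun a ha b hb => hT ha hb

/-- A finite subsemigroup that is not nilpotent contains a nonzero idempotent. -/
theorem IsSubsgp.exists_idempotent_ne_zero {S : Type*} [SemigroupWithZero S] [Finite S]
    {T : Set S} (hT : IsSubsgp T) (hnil : ¬ ∃ k : ℕ, 1 ≤ k ∧ ProdZero T k) :
    ∃ e ∈ T, e * e = e ∧ e ≠ 0 := by
  have hlong : ¬ ProdZero T (Nat.card S + 1) := fun h => hnil ⟨_, Nat.le_add_left _ _, h⟩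
  unfold ProdZero at hlong
  push Not at hlong
  obtain ⟨a, l, ha, hl, hlen, hprod⟩ := hlong
  have hprefix : ∀ i, prodl a (l.take i) ≠ 0 := by
    intro i h
    apply hprod
    rw [← List.take_append_drop i l, prodl_append, h, zero_prodl]
  obtain ⟨i, j, hij, heq⟩ : ∃ i j : Fin (Nat.card S + 1), i < j ∧
      prodl a (l.take i) = prodl a (l.take j) := by
    have := Fintype.ofFinite S
    obtain ⟨i, j, hne, heq⟩ := Fintype.exists_ne_map_eq_of_card_lt
      (fun i : Fin (Nat.card S + 1) => prodl a (l.take i))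
      (by simp [Nat.card_eq_fintype_card])
    rcases lt_or_gt_of_ne hne with h | h
    · exact ⟨i, j, h, heq⟩
    · exact ⟨j, i, h, heq.symm⟩
  have hij' : (i : ℕ) < j := hij
  set P := prodl a (l.take i)
  let F : Set S := {w | w ∈ T ∧ P * w = P}
  have hF : IsSubsgp F := fun u v hu hv => ⟨hT hu.1 hv.1, by rw [← mul_assoc, hu.2, hv.2]⟩
  have hFne : F.Nonempty := by
    have hsplit : l.take j = l.take i ++ (l.drop i).take (j - i) := by
      rw [← List.take_add]
      congr 1
      omega
    have hsub : ∀ x ∈ (l.drop i).take (j - i), x ∈ T := fun x hx =>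
      hl x (List.mem_of_mem_drop (List.mem_of_mem_take hx))
    rw [hsplit, prodl_append] at heq
    cases hm : (l.drop i).take (j - i) with
    | nil =>
      have := congrArg List.length hm
      simp at this
      omega
    | cons b m =>
      rw [hm] at heq hsub
      refine ⟨prodl b m, hT.prodl_mem (hsub b List.mem_cons_self)
        fun x hx => hsub x (List.mem_cons_of_mem b hx), ?_⟩
      rw [← prodl_mul]
      exact heq.symm
  obtain ⟨e, he, hee⟩ := hF.exists_idempotent hFne
  refine ⟨e, he.1, hee, ?_⟩
  rintro rfl
  exact hprefix i (by simpa using he.2.symm)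

/-- If the radical is trivial, every nonzero principal ideal of a finite semigroup contains a
minimal idempotent. -/
theorem exists_minIdem_mem_pId {S : Type*} [SemigroupWithZero S] [Finite S]
    (hrad : radical S = {0}) {x : S} (hx : x ≠ 0) : ∃ e ∈ pId x, MinIdem e := by
  obtain ⟨y, ⟨hyx, hy0⟩, hmin⟩ := Set.exists_min_image {y | y ∈ pId x ∧ y ≠ 0}
    (fun y => (pId y).ncard) (Set.toFinite _) ⟨x, self_mem_pId x, hx⟩
  have hyeq : ∀ b ∈ pId y, b ≠ 0 → pId b = pId y := fun b hb hb0 =>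
    Set.eq_of_subset_of_ncard_le (pId_subset_of_mem hb)
      (hmin b ⟨pId_subset_of_mem hyx hb, hb0⟩)
  have hnil : ¬ ∃ k : ℕ, 1 ≤ k ∧ ProdZero (pId y) k := by
    intro h
    have hmem : y ∈ radical S := h
    rw [hrad] at hmem
    exact hy0 hmem
  have hsub : IsSubsgp (pId y) := fun a _ _ hb => mul_left_mem_pId a hb
  obtain ⟨e, hey, hee, he0⟩ := hsub.exists_idempotent_ne_zero hnil
  have heq := hyeq e hey he0
  refine ⟨e, pId_subset_of_mem hyx hey, hee, he0, fun b hb => ?_⟩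
  by_cases hb0 : b = 0
  · exact .inl hb0
  · exact .inr ((hyeq b (heq ▸ hb (self_mem_pId b)) hb0).trans heq.symm)

/-- An idempotent `e ∈ (x)` factors as `e = p * x * q` with `p ∈ eS` and `q ∈ Se`. -/
theorem exists_factorization_of_mem_pId {S : Type*} [Semigroup S] {e x : S} (hee : e * e = e)
    (h : e ∈ pId x) : ∃ p q, p * x * q = e ∧ e * p = p ∧ q * e = q := by
  have key : ∃ s t, e = s * x * t := by
    rcases mem_pId.1 h with h | ⟨u, h⟩ | ⟨v, h⟩ | h
    · exact ⟨e, e, by rw [← h, hee, hee]⟩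
    · exact ⟨u, e, by rw [← h, hee]⟩
    · exact ⟨e, v, by rw [mul_assoc, ← h, hee]⟩
    · exact h
  obtain ⟨s, t, hst⟩ := key
  refine ⟨e * s, t * e, ?_, by rw [← mul_assoc, hee], by rw [mul_assoc, hee]⟩
  calc e * s * x * (t * e) = e * (s * x * t) * e := by simp only [mul_assoc]
    _ = e := by rw [← hst, hee, hee]

/-- Let `S` be a finite semigroup with zero with
`R(S) = {0}` and let `x ∈ S` be nonzero. Then there exist idempotents
`e, f ∈ S` lying in the same minimal D-class (`(e) = (f)` and this class is
minimal) such that `e * x * f ≠ 0`. -/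
theorem statement15 {S : Type*} [SemigroupWithZero S] [Finite S]
    (hrad : radical S = {0}) (x : S) (hx : x ≠ 0) :
    ∃ e f : S, e * e = e ∧ f * f = f ∧ InMinClass e ∧ pId e = pId f ∧
      e * x * f ≠ 0 := by
  obtain ⟨e, hex, hee, he0, hmin⟩ := exists_minIdem_mem_pId hrad hx
  obtain ⟨p, q, hpq, hp, hq⟩ := exists_factorization_of_mem_pId hee hex
  have hqp : q * p ∈ pId e :=
    mem_pId.2 (.inr (.inr (.inr ⟨q, p, by rw [hq]⟩)))
  have hcollapse : p * (x * (q * p) * x) * q = e := by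
    calc p * (x * (q * p) * x) * q = (p * x * q) * (p * x * q) := by simp only [mul_assoc]
      _ = e := by rw [hpq, hee]
  have hne : x * (q * p) * x ≠ 0 := by
    intro h
    rw [h, mul_zero, zero_mul] at hcollapse
    exact he0 hcollapse.symm
  have hmid : q * p * x * (q * p) = q * p := by
    calc q * p * x * (q * p) = q * (p * x * q) * p := by simp only [mul_assoc]
      _ = q * p := by rw [hpq, hq]
  have hl0 : x * (q * p) ≠ 0 := fun h => hne (by rw [h, zero_mul])
  have hr0 : q * p * x ≠ 0 := fun h => hne (by rw [mul_assoc, h, mul_zero])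
  have hl : pId (x * (q * p)) = pId e :=
    (hmin _ (pId_subset_of_mem (mul_left_mem_pId x hqp))).resolve_left hl0
  have hr : pId (q * p * x) = pId e :=
    (hmin _ (pId_subset_of_mem (mul_right_mem_pId x hqp))).resolve_left hr0
  refine ⟨x * (q * p), q * p * x, ?_, ?_, ⟨hl0, by rwa [hl]⟩, hl.trans hr.symm, ?_⟩
  · calc x * (q * p) * (x * (q * p)) = x * (q * p * x * (q * p)) := by simp only [mul_assoc]
      _ = x * (q * p) := by rw [hmid]
  · rw [← mul_assoc, hmid]
  · have : x * (q * p) * x * (q * p * x) = x * (q * p) * x := by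
      calc x * (q * p) * x * (q * p * x) = x * (q * p * x * (q * p)) * x := by
            simp only [mul_assoc]
        _ = x * (q * p) * x := by rw [hmid]
    rwa [this]
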